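/- arXiv:1707.00850 — 6 statements merged into one kernel-verified Lean document; each statement's English description precedes it below -/
import Mathlib

section
/- Let q be a prime power, let m_1 divide m_2, let F be a finite field with q^{m_2} elements and K ⊆ F its subfield with q^{m_1} elements. Let a_1,…,a_n be n ≥ 1 nonzero elements of F. Then all the elementary symmetric polynomial values σ_i(a_1,…,a_n), 0 ≤ i ≤ n, lie in K if and only if all the values σ_i(a_1^{−q},…,a_n^{−q}), 0 ≤ i ≤ n, lie in K. -/
/-- The elementary symmetric functions of the inverses, up to the product of all the entries. -/
theorem sum_powersetCard_prod_inv_mul_prod {ι F : Type*} [Fintype ι] [Field F]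
    (a : ι → F) (ha : ∀ i, a i ≠ 0) {k : ℕ} (hk : k ≤ Fintype.card ι) :
    (∑ s ∈ Finset.powersetCard k Finset.univ, ∏ j ∈ s, (a j)⁻¹) * ∏ j, a j =
      ∑ s ∈ Finset.powersetCard (Fintype.card ι - k) Finset.univ, ∏ j ∈ s, a j := by
  classical
  rw [Finset.sum_mul]
  refine Finset.sum_nbij' (fun s => sᶜ) (fun s => sᶜ) ?_ ?_ (fun s _ => compl_compl s)
    (fun s _ => compl_compl s) ?_
  · intro s hs
    rw [Finset.mem_powersetCard_univ] at hs ⊢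
    rw [Finset.card_compl, hs]
  · intro s hs
    rw [Finset.mem_powersetCard_univ] at hs ⊢
    rw [Finset.card_compl, hs]
    omega
  · intro s _
    rw [← Finset.prod_mul_prod_compl s a, ← mul_assoc, ← Finset.prod_mul_distrib,
      Finset.prod_congr rfl fun i _ => inv_mul_cancel₀ (ha i), Finset.prod_const_one, one_mul]

theorem sum_powersetCard_prod_inv_mem {ι F : Type*} [Fintype ι] [Field F] (K : Subfield F)
    (a : ι → F) (ha : ∀ i, a i ≠ 0)
    (h : ∀ k ≤ Fintype.card ι, ∑ s ∈ Finset.powersetCard k Finset.univ, ∏ j ∈ s, a j ∈ K) :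
    ∀ k ≤ Fintype.card ι, ∑ s ∈ Finset.powersetCard k Finset.univ, ∏ j ∈ s, (a j)⁻¹ ∈ K := by
  intro k hk
  have hprod : ∏ j, a j ∈ K := by
    have := h _ le_rfl
    rwa [← Finset.card_univ, Finset.powersetCard_self, Finset.sum_singleton] at this
  rw [eq_div_of_mul_eq (Finset.prod_ne_zero_iff.2 fun i _ => ha i)
    (sum_powersetCard_prod_inv_mul_prod a ha hk)]
  exact K.div_mem (h _ (Nat.sub_le _ _)) hprod

theorem Subfield.map_mem_iff_of_finite {F : Type*} [Field F] (K : Subfield F) [Finite K]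
    (f : F →+* F) (hf : ∀ x ∈ K, f x ∈ K) {x : F} : f x ∈ K ↔ x ∈ K := by
  refine ⟨fun hx => ?_, hf x⟩
  have hinj : Function.Injective fun y : K => (⟨f y, hf y y.2⟩ : K) := fun y z hyz =>
    Subtype.ext (f.injective (congrArg Subtype.val hyz))
  obtain ⟨y, hy⟩ := Finite.surjective_of_injective hinj ⟨f x, hx⟩
  rw [← f.injective (congrArg Subtype.val hy)]
  exact y.2

/-- for a finite field `F` with `q^{m₂}` elements and its subfield `K` with
`q^{m₁}` elements (`m₁ ∣ m₂`), and nonzero elements `a_1, …, a_n` of `F`, all the elementary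
symmetric function values `σ_k(a_1,…,a_n)` lie in `K` iff all the values
`σ_k(a_1^{−q},…,a_n^{−q})` lie in `K`. -/
theorem esymm_mem_subfield_iff_esymm_inv_pow_mem
    (q : ℕ) (hq : IsPrimePow q) (m₁ m₂ : ℕ) (hm₁ : 1 ≤ m₁) (hdvd : m₁ ∣ m₂)
    (F : Type) [Field F] [Fintype F] (hF : Fintype.card F = q ^ m₂)
    (K : Subfield F) (hK : Nat.card K = q ^ m₁)
    (n : ℕ) (hn : 1 ≤ n) (a : Fin n → F) (ha : ∀ i, a i ≠ 0) :
    (∀ k : ℕ, k ≤ n →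
        (∑ s ∈ Finset.powersetCard k (Finset.univ : Finset (Fin n)), ∏ j ∈ s, a j) ∈ K) ↔
    (∀ k : ℕ, k ≤ n →
        (∑ s ∈ Finset.powersetCard k (Finset.univ : Finset (Fin n)), ∏ j ∈ s, (a j)⁻¹ ^ q) ∈ K) := by
  obtain ⟨p, e, hp, -, rfl⟩ := (isPrimePow_nat_iff q).1 hq
  have : Fact p.Prime := ⟨hp⟩
  have : CharP F p :=
    charP_of_card_eq_prime_pow (f := e * m₂) (by rw [hF, pow_mul])
  have hpow : ∀ k, ∑ s ∈ Finset.powersetCard k Finset.univ, ∏ j ∈ s, (a j)⁻¹ ^ p ^ e =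
      iterateFrobenius F p e (∑ s ∈ Finset.powersetCard k Finset.univ, ∏ j ∈ s, (a j)⁻¹) := by
    intro k
    simp only [map_sum, map_prod, iterateFrobenius_def]
  have hmem : ∀ x, iterateFrobenius F p e x ∈ K ↔ x ∈ K := fun x =>
    K.map_mem_iff_of_finite _ fun y hy => by
      rw [iterateFrobenius_def]
      exact K.pow_mem hy _
  simp only [hpow, hmem]
  constructor
  · intro h
    simpa only [Fintype.card_fin] using sum_powersetCard_prod_inv_mem K a ha
      (by simpa only [Fintype.card_fin] using h)
  · intro h
    simpa only [Fintype.card_fin, inv_inv] using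
      sum_powersetCard_prod_inv_mem K (fun i => (a i)⁻¹) (fun i => inv_ne_zero (ha i))
        (by simpa only [Fintype.card_fin] using h)
end

section
/- For every prime power q and every integer m > 0, the number of self-dual monic polynomials in F_{q^2}[x] of degree m with nonzero constant term is exactly q^m + q^{m−1}. -/
open Polynomial

/-- The dual polynomial: if `p = a₀ ∏ (X − αᵢ)` over its splitting field, the dual is
`a₀ ∏ (X − αᵢ^{−q})`, regarded as a polynomial over the splitting field. -/
noncomputable def dualPoly {F : Type*} [Field F] (q : ℕ) (p : Polynomial F) :
    Polynomial p.SplittingField :=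
  Polynomial.C (algebraMap F p.SplittingField p.leadingCoeff) *
    ((p.aroots p.SplittingField).map fun α => Polynomial.X - Polynomial.C (α⁻¹ ^ q)).prod

/-- A polynomial is self-dual if it coincides with its dual polynomial. -/
def IsSelfDual {F : Type*} [Field F] (q : ℕ) (p : Polynomial F) : Prop :=
  p.map (algebraMap F p.SplittingField) = dualPoly q p

/-- A semilinear involution over a quadratic extension has as many fixed points as the square root
of the size of the space. -/
theorem card_fixed_sq_of_semilinear_involution {F V : Type*} [Field F] [AddCommGroup V]
    [Module F V] (σ : F →+* F) (θ : F) (hσθ : σ (σ θ) = θ) (hθ : σ θ ≠ θ) (T : V →ₛₗ[σ] V)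
    (hT : ∀ v, T (T v) = v) : Nat.card {v // T v = v} ^ 2 = Nat.card V := by
  have hne : θ - σ θ ≠ 0 := sub_ne_zero.mpr hθ.symm
  have hb : ∀ x, T ((θ - σ θ)⁻¹ • (x - T x)) = (θ - σ θ)⁻¹ • (x - T x) := fun x => by
    rw [map_smulₛₗ, map_inv₀, map_sub, map_sub, hT, hσθ, ← neg_sub θ, ← neg_sub x, inv_neg,
      neg_smul_neg]
  rw [sq, ← Nat.card_prod]
  refine Nat.card_congr (Equiv.ofBijective (fun ab => ab.1.1 + θ • ab.2.1) ⟨?_, fun x => ?_⟩)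
  · rintro ⟨⟨a, ha⟩, ⟨b, hb⟩⟩ ⟨⟨a', ha'⟩, ⟨b', hb'⟩⟩ h
    simp only at h
    have h2 : a + σ θ • b = a' + σ θ • b' := by
      simpa [map_add, map_smulₛₗ, ha, ha', hb, hb'] using congrArg T h
    have h3 : (θ - σ θ) • b = (θ - σ θ) • b' := by
      have := congrArg₂ (· - ·) h h2
      simpa [sub_smul] using this
    have h4 : b = b' := smul_right_injective V hne h3
    subst h4
    simpa using h
  · refine ⟨⟨⟨x - θ • (θ - σ θ)⁻¹ • (x - T x), ?_⟩, ⟨_, hb x⟩⟩, by simp⟩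
    rw [map_sub, map_smulₛₗ, hb, sub_eq_sub_iff_sub_eq_sub, ← neg_sub x, ← neg_sub (θ • _),
      ← sub_smul, smul_inv_smul₀ hne]

/-- The twisted reversal `c ↦ (i ↦ u * σ (c (rev i)))` as a semilinear map. -/
def twistedRev {F : Type*} [Field F] (σ : F →+* F) (u : F) (n : ℕ) :
    (Fin n → F) →ₛₗ[σ] (Fin n → F) where
  toFun c i := u * σ (c i.rev)
  map_add' c d := by ext i; simp [mul_add]
  map_smul' a c := by ext i; simp [mul_left_comm]

theorem card_twistedRev_fixed {F : Type*} [Field F] [Fintype F] {q : ℕ}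
    (hF : Fintype.card F = q ^ 2) (σ : F →+* F) (hσ : ∀ x, σ (σ x) = x) (θ : F) (hθ : σ θ ≠ θ)
    (u : F) (hu : u * σ u = 1) (n : ℕ) :
    Nat.card {c : Fin n → F // ∀ i, u * σ (c i.rev) = c i} = q ^ n := by
  have h := card_fixed_sq_of_semilinear_involution σ θ (hσ θ) hθ (twistedRev σ u n) fun v => by
    ext i
    simp [twistedRev, hσ, ← mul_assoc, hu]
  have hcard : Nat.card (Fin n → F) = (q ^ n) ^ 2 := by
    rw [Nat.card_fun, Nat.card_eq_fintype_card, hF, Nat.card_fin]; ring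
  rw [hcard] at h
  rw [← Nat.pow_left_injective two_ne_zero h]
  exact Nat.card_congr (Equiv.subtypeEquivRight fun c => funext_iff.symm)

theorem reverse_prod_X_sub_C {L : Type*} [Field L] (s : Multiset L) (hs : 0 ∉ s) :
    (s.map fun a => X - C a).prod.reverse =
      C ((s.map fun a => X - C a).prod.coeff 0) * (s.map fun a => X - C a⁻¹).prod := by
  induction s using Multiset.induction_on with
  | empty => simpa using reverse_C (1 : L)
  | cons a s ih =>
    simp only [Multiset.mem_cons, not_or] at hs
    have ha : a ≠ 0 := Ne.symm hs.1
    have h1 : (X - C a).reverse = C (-a) * (X - C a⁻¹) := by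
      ext i
      rw [coeff_reverse, natDegree_X_sub_C]
      rcases i with _ | _ | i
      · simp [revAt_le, ha]
      · simp [revAt_le, coeff_C]
      · rw [revAt_eq_self_of_lt (by omega)]
        simp [coeff_X]
    simp only [Multiset.map_cons, Multiset.prod_cons, reverse_mul_of_domain, ih hs.2, h1,
      mul_coeff_zero, C_mul]
    simp only [coeff_sub, coeff_X_zero, coeff_C_zero, zero_sub]
    ring

theorem isSelfDual_iff_coeff {F : Type*} [Field F] {q : ℕ} (ℓ k : ℕ) [Fact ℓ.Prime] [CharP F ℓ]
    (hq : ℓ ^ k = q) {p : F[X]} (hp : p.Monic) (h0 : p.coeff 0 ≠ 0) :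
    IsSelfDual q p ↔
      ∀ i, p.coeff (revAt p.natDegree i) ^ q = p.coeff 0 ^ q * p.coeff i := by
  have : CharP p.SplittingField ℓ := charP_of_injective_algebraMap (algebraMap F _).injective ℓ
  set A := algebraMap F p.SplittingField with hA
  let τ := iterateFrobenius p.SplittingField ℓ k
  have hτ : ∀ x, τ x = x ^ q := fun x => by rw [← hq]; rfl
  have hprod : p.map A = ((p.aroots p.SplittingField).map fun a => X - C a).prod :=
    (SplittingField.splits p).eq_prod_roots_of_monic (hp.map _)
  have hroots : 0 ∉ ((p.aroots p.SplittingField).map τ) := by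
    intro h
    obtain ⟨a, ha, ha0⟩ := Multiset.mem_map.mp h
    rw [map_eq_zero] at ha0
    subst ha0
    have := (mem_aroots.mp ha).2
    rw [aeval_def, eval₂_at_zero, map_eq_zero] at this
    exact h0 this
  have hmap : (p.map A).map τ =
      (((p.aroots p.SplittingField).map τ).map fun a => X - C a).prod := by
    conv_lhs => rw [hprod]
    rw [← coe_mapRingHom, map_multiset_prod, Multiset.map_map, Multiset.map_map]
    simp
  have hrev := reverse_prod_X_sub_C _ hroots
  rw [← hmap, Multiset.map_map] at hrev
  have hdual : dualPoly q p =
      ((p.aroots p.SplittingField).map ((fun a => X - C a⁻¹) ∘ τ)).prod := by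
    rw [dualPoly, hp.leadingCoeff, map_one, map_one, one_mul]
    simp [hτ]
  rw [← hdual, coeff_map, coeff_map] at hrev
  have hc : C (τ (A (p.coeff 0))) ≠ 0 := by simpa using h0
  rw [IsSelfDual, ← mul_right_inj' hc, ← hrev, Polynomial.ext_iff]
  refine forall_congr' fun i => ?_
  rw [coeff_reverse, natDegree_map, natDegree_map, coeff_map, coeff_map, coeff_C_mul, coeff_map,
    hτ, hτ, ← map_pow, ← map_pow, ← map_mul, A.injective.eq_iff, eq_comm]

theorem isSelfDual_iff_coeff_rev {F : Type*} [Field F] {q : ℕ} (ℓ k : ℕ) [Fact ℓ.Prime]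
    [CharP F ℓ] (hq : ℓ ^ k = q) {n : ℕ} {p : F[X]} (hp : p.Monic) (hn : p.natDegree = n + 1) :
    (p.coeff 0 ≠ 0 ∧ IsSelfDual q p) ↔ p.coeff 0 ^ (q + 1) = 1 ∧
      ∀ i : Fin n, p.coeff 0 * p.coeff (i.rev + 1) ^ q = p.coeff (i + 1) := by
  have hlead : p.coeff (n + 1) = 1 := hn ▸ hp.coeff_natDegree
  have hq0 : q ≠ 0 := hq ▸ pow_ne_zero _ (Fact.out : ℓ.Prime).ne_zero
  constructor
  · rintro ⟨h0, h⟩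
    rw [isSelfDual_iff_coeff ℓ k hq hp h0, hn] at h
    have h1 : p.coeff 0 ^ (q + 1) = 1 := by
      have := h 0
      rw [revAt_le (by omega), Nat.sub_zero, hlead, one_pow] at this
      rw [pow_succ, ← this]
    refine ⟨h1, fun i => ?_⟩
    have := h (i + 1)
    rw [revAt_le (by omega)] at this
    rw [Fin.val_rev, show n - (i + 1) + 1 = n + 1 - (i + 1) by omega, this, ← mul_assoc,
      ← pow_succ', h1, one_mul]
  · rintro ⟨h1, h⟩
    have h0 : p.coeff 0 ≠ 0 := fun h0 => by simp [h0] at h1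
    refine ⟨h0, ?_⟩
    rw [isSelfDual_iff_coeff ℓ k hq hp h0, hn]
    intro i
    rcases Nat.lt_or_ge (n + 1) i with hi | hi
    · rw [revAt_eq_self_of_lt hi, coeff_eq_zero_of_natDegree_lt (hn ▸ hi), zero_pow hq0, mul_zero]
    rw [revAt_le hi]
    rcases i with _ | i
    · rw [Nat.sub_zero, hlead, one_pow, ← pow_succ, h1]
    rcases Nat.lt_or_ge i n with hi' | hi'
    · have := h ⟨i, hi'⟩
      rw [Fin.val_rev] at this
      simp only at this
      rw [← this, ← mul_assoc, ← pow_succ, h1, one_mul]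
      congr 2
      omega
    · obtain rfl : i = n := by omega
      rw [Nat.sub_self, hlead, mul_one]

/-- A monic polynomial of degree `n + 1` amounts to its constant coefficient together with its
middle coefficients. -/
theorem bijective_coeffs_monic (F : Type*) [Field F] (n : ℕ) :
    Function.Bijective fun p : {p : F[X] // p.Monic ∧ p.natDegree = n + 1} =>
      ((p.1.coeff 0, fun i => p.1.coeff (i + 1)) : F × (Fin n → F)) := by
  constructor
  · rintro ⟨p, hp, hpn⟩ ⟨r, hr, hrn⟩ h
    simp only [Prod.mk.injEq, funext_iff] at h
    refine Subtype.ext (Polynomial.ext fun i => ?_)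
    rcases i with _ | i
    · exact h.1
    rcases lt_trichotomy i n with hi | rfl | hi
    · exact h.2 ⟨i, hi⟩
    · have h1 := hp.coeff_natDegree
      have h2 := hr.coeff_natDegree
      rw [hpn] at h1
      rw [hrn] at h2
      rw [h1, h2]
    · have hi' : n + 1 < i + 1 := by omega
      rw [coeff_eq_zero_of_natDegree_lt (hpn.trans_lt hi'),
        coeff_eq_zero_of_natDegree_lt (hrn.trans_lt hi')]
  · rintro ⟨u, c⟩
    classical
    have hdeg := ofFn_degree_lt (Fin.cons u c : Fin (n + 1) → F)
    have hnat : (X ^ (n + 1) + ofFn (n + 1) (Fin.cons u c : Fin (n + 1) → F)).natDegree = n + 1 := by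
      rw [natDegree_add_eq_left_of_degree_lt (by simpa using hdeg), natDegree_X_pow]
    refine ⟨⟨_, monic_X_pow_add hdeg, hnat⟩, Prod.ext ?_ (funext fun i => ?_)⟩
    · simp [coeff_X_pow, ofFn_coeff_eq_val_of_lt]
    · have hi : (i : ℕ) + 1 < n + 1 := by omega
      have : (⟨i + 1, hi⟩ : Fin (n + 1)) = i.succ := rfl
      simp only [coeff_add, coeff_X_pow, ofFn_coeff_eq_val_of_lt _ hi, hi.ne, this, if_false,
        Fin.cons_succ, zero_add]

theorem card_pow_succ_eq_one {F : Type*} [Field F] [Fintype F] {q : ℕ}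
    (hF : Fintype.card F = q ^ 2) : Nat.card {u : F // u ^ (q + 1) = 1} = q + 1 := by
  have h := IsCyclic.card_powMonoidHom_ker (G := Fˣ) (q + 1)
  have hdvd : q + 1 ∣ Nat.card Fˣ := by
    rw [Nat.card_units, Nat.card_eq_fintype_card, hF]
    exact ⟨q - 1, by simpa using Nat.sq_sub_sq q 1⟩
  rw [Nat.gcd_eq_right hdvd] at h
  have hmem (u : Fˣ) : u ∈ (powMonoidHom (q + 1) : Fˣ →* Fˣ).ker ↔ (u : F) ^ (q + 1) = 1 := by
    rw [MonoidHom.mem_ker, powMonoidHom_apply, ← Units.val_inj, Units.val_pow_eq_pow_val,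
      Units.val_one]
  refine (Nat.card_congr (Equiv.ofBijective
    (fun u : (powMonoidHom (q + 1) : Fˣ →* Fˣ).ker =>
      (⟨(u.1 : F), (hmem u.1).mp u.2⟩ : {u : F // u ^ (q + 1) = 1}))
    ⟨fun u v huv => Subtype.ext (Units.ext (congrArg Subtype.val huv)), fun u => ?_⟩)).symm.trans h
  have hu : u.1 ≠ 0 := fun h0 => by simpa [h0] using u.2
  exact ⟨⟨Units.mk0 u.1 hu, (hmem _).mpr u.2⟩, rfl⟩

theorem exists_pow_ne_self {F : Type*} [Field F] [Fintype F] {q : ℕ} (hq : 1 < q)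
    (hF : Fintype.card F = q ^ 2) : ∃ θ : F, θ ^ q ≠ θ := by
  by_contra! h
  have hdeg := FiniteField.X_pow_card_sub_X_natDegree_eq F hq
  have h0 := FiniteField.X_pow_card_sub_X_ne_zero F hq
  have := card_le_degree_of_subset_roots (p := (X ^ q - X : F[X])) (Z := Finset.univ)
    fun x _ => by simp [mem_roots h0, h x]
  rw [Finset.card_univ, hF, hdeg] at this
  nlinarith

/-- the number of self-dual monic polynomials over `F_{q²}` of degree `m > 0`
with nonzero constant term is `q^m + q^{m−1}`. -/
theorem card_selfDual_monic_eq
    (q : ℕ) (hq : IsPrimePow q) (F : Type) [Field F] [Fintype F]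
    (hF : Fintype.card F = q ^ 2) (m : ℕ) (hm : 0 < m) :
    Nat.card {p : Polynomial F // p.Monic ∧ p.natDegree = m ∧ p.coeff 0 ≠ 0 ∧ IsSelfDual q p} =
      q ^ m + q ^ (m - 1) := by
  classical
  obtain ⟨n, rfl⟩ : ∃ n, m = n + 1 := ⟨m - 1, by omega⟩
  obtain ⟨ℓ, k, hℓ, hk, hℓk⟩ := (isPrimePow_nat_iff q).mp hq
  have : Fact ℓ.Prime := ⟨hℓ⟩
  have : CharP F ℓ := charP_of_card_eq_prime_pow (f := k * 2) (by rw [hF, ← hℓk, pow_mul])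
  let σ := iterateFrobenius F ℓ k
  have hσ : ∀ x, σ x = x ^ q := fun x => by rw [← hℓk]; rfl
  have hσσ : ∀ x, σ (σ x) = x := fun x => by
    rw [hσ, hσ, ← pow_mul, ← sq, ← hF, FiniteField.pow_card]
  obtain ⟨θ, hθ⟩ := exists_pow_ne_self hq.one_lt hF
  let e := Equiv.ofBijective _ (bijective_coeffs_monic F n)
  let Q : F → (Fin n → F) → Prop := fun u c =>
    u ^ (q + 1) = 1 ∧ ∀ i, u * c i.rev ^ q = c i
  have e₁ : {p : F[X] // p.Monic ∧ p.natDegree = n + 1 ∧ p.coeff 0 ≠ 0 ∧ IsSelfDual q p} ≃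
      {p : {p : F[X] // p.Monic ∧ p.natDegree = n + 1} //
        p.1.coeff 0 ≠ 0 ∧ IsSelfDual q p.1} :=
    (Equiv.subtypeEquivRight fun p => and_assoc.symm).trans
      (Equiv.subtypeSubtypeEquivSubtypeInter _
        fun p : F[X] => p.coeff 0 ≠ 0 ∧ IsSelfDual q p).symm
  have e₂ : {p : {p : F[X] // p.Monic ∧ p.natDegree = n + 1} //
        p.1.coeff 0 ≠ 0 ∧ IsSelfDual q p.1} ≃ {x : F × (Fin n → F) // Q x.1 x.2} :=
    e.subtypeEquiv fun p => isSelfDual_iff_coeff_rev ℓ k hℓk p.2.1 p.2.2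
  have hfiber : ∀ u, Nat.card {c // Q u c} = if u ^ (q + 1) = 1 then q ^ n else 0 := fun u => by
    split_ifs with hu
    · rw [← card_twistedRev_fixed hF σ hσσ θ (by rwa [hσ]) u (by rw [hσ, ← pow_succ', hu]) n]
      exact Nat.card_congr (Equiv.subtypeEquivRight fun c => by simp [Q, hu, hσ])
    · simp [Q, hu]
  rw [Nat.card_congr (e₁.trans (e₂.trans (Equiv.subtypeProdEquivSigmaSubtype Q))), Nat.card_sigma,
    Finset.sum_congr rfl fun u _ => hfiber u, ← Finset.sum_filter, Finset.sum_const, smul_eq_mul,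
    ← Fintype.card_subtype, ← Nat.card_eq_fintype_card,
    card_pow_succ_eq_one hF, Nat.add_sub_cancel]
  ring
end

section
/- Let p(x) ∈ F_{q^2}[x] be a self-dual irreducible monic polynomial of degree m ≥ 1 with p(0) ≠ 0. Then m is odd, and there exists an element λ of the field F_{q^{2m}} with q^{2m} elements such that λ^{q^m + 1} = 1, the m elements λ, λ^{q^2}, λ^{q^4}, …, λ^{q^{2m−2}} are pairwise distinct, and p(x) = ∏_{j=0}^{m−1} (x − λ^{q^{2j}}). -/
open Polynomial

/-- If `f` is self-dual, then the roots of `f` in any extension in which `f` splits are stable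
under `x ↦ x^{−q}`. -/
theorem IsSelfDual.isRoot_inv_pow {F K : Type*} [Field F] [Field K] [Algebra F K] {q : ℕ}
    {f : F[X]} (hf : IsSelfDual q f) (hf0 : f ≠ 0) (hsplit : (f.map (algebraMap F K)).Splits)
    {x : K} (hx : aeval x f = 0) : aeval (x⁻¹ ^ q) f = 0 := by
  let φ : f.SplittingField →ₐ[F] K := IsSplittingField.lift f.SplittingField f hsplit
  have hroots : (f.aroots f.SplittingField).map φ = f.aroots K := by
    have h := (SplittingField.splits f).roots_map φ.toRingHom
    rw [Polynomial.map_map] at h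
    simp only [aroots_def]
    rw [show algebraMap F K = φ.toRingHom.comp (algebraMap F f.SplittingField) from
      φ.comp_algebraMap.symm, h]
    rfl
  have hmem : x ∈ f.aroots K := mem_aroots.2 ⟨hf0, hx⟩
  rw [← hroots, Multiset.mem_map] at hmem
  obtain ⟨y, hy, rfl⟩ := hmem
  have hy' : aeval (y⁻¹ ^ q) f = 0 := by
    rw [aeval_def, ← eval_map, show f.map _ = dualPoly q f from hf, dualPoly, eval_mul,
      eval_multiset_prod, Multiset.prod_eq_zero, mul_zero]
    rw [Multiset.map_map]
    exact Multiset.mem_map.2 ⟨y, hy, by simp⟩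
  rw [← map_inv₀, ← map_pow, aeval_algHom_apply, hy', map_zero]

/-- The conjugates of a primitive element `x` of a finite extension `L / K` of finite fields
under the Frobenius repeat exactly with period `[L : K]`. -/
theorem FiniteField.pow_card_pow_eq_pow_card_pow_iff {K L : Type*} [Field K] [Fintype K] [Field L]
    [Finite L] [Algebra K L] {x : L} (hx : IntermediateField.adjoin K {x} = ⊤) {a b : ℕ} :
    x ^ Fintype.card K ^ a = x ^ Fintype.card K ^ b ↔ a ≡ b [MOD Module.finrank K L] := by
  have hpow (n : ℕ) (y : L) : (frobeniusAlgHom K L ^ n) y = y ^ Fintype.card K ^ n := by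
    rw [AlgHom.coe_pow, coe_frobeniusAlgHom, pow_iterate]
  have hfin : IsOfFinOrder (frobeniusAlgHom K L) :=
    orderOf_pos_iff.1 (orderOf_frobeniusAlgHom K L ▸ Module.finrank_pos)
  rw [← orderOf_frobeniusAlgHom K L, ← hfin.pow_eq_pow_iff_modEq, ← hpow, ← hpow]
  refine ⟨fun h => AlgHom.ext_of_adjoin_eq_top (s := {x}) ?_ ?_, fun h => by rw [h]⟩
  · rw [← IntermediateField.adjoin_simple_toSubalgebra_of_isAlgebraic
      (Algebra.IsAlgebraic.isAlgebraic x), hx, IntermediateField.top_toSubalgebra]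
  · rintro y rfl
    exact h

/-- A monic polynomial over a finite field `K` of degree `m` with a root `x` whose conjugates
`x^{|K|^j}`, `0 ≤ j < m`, are pairwise distinct is the product of the `X - x^{|K|^j}`. -/
theorem FiniteField.map_eq_prod_X_sub_C_pow_card_pow {K L : Type*} [Field K] [Fintype K] [Field L]
    [Algebra K L] {f : K[X]} (hf : f.Monic) {m : ℕ} (hdeg : f.natDegree = m) {x : L}
    (hx : aeval x f = 0) (hinj : Function.Injective fun j : Fin m => x ^ Fintype.card K ^ (j : ℕ)) :
    f.map (algebraMap K L) = ∏ j : Fin m, (X - C (x ^ Fintype.card K ^ (j : ℕ))) := by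
  refine eq_of_monic_of_dvd_of_natDegree_le (monic_prod_X_sub_C _ _) (hf.map _) ?_ ?_
  · refine Finset.prod_dvd_of_coprime ((pairwise_coprime_X_sub_C hinj).set_pairwise _) fun j _ => ?_
    have hroot : aeval ((frobeniusAlgHom K L ^ (j : ℕ)) x) f = 0 := by
      rw [aeval_algHom_apply, hx, map_zero]
    rw [AlgHom.coe_pow, coe_frobeniusAlgHom, pow_iterate] at hroot
    rwa [dvd_iff_isRoot, IsRoot, eval_map_algebraMap]
  · rw [natDegree_prod_of_monic _ _ fun _ _ => monic_X_sub_C _]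
    simp [-map_pow, hdeg]

/-- a self-dual irreducible monic polynomial `p` of degree `m ≥ 1` over
`F_{q²}` with `p(0) ≠ 0` has odd degree, and over the field `K` with `q^{2m}` elements
`p(x) = ∏_{j=0}^{m−1} (x − λ^{q^{2j}})` for some `λ ∈ K` with `λ^{q^m+1} = 1` and the
elements `λ^{q^{2j}}`, `0 ≤ j ≤ m−1`, pairwise distinct. -/
theorem selfDual_irreducible_odd_degree_and_roots
    (q : ℕ) (hq : IsPrimePow q) (F : Type) [Field F] [Fintype F]
    (hF : Fintype.card F = q ^ 2) (m : ℕ) (hm : 1 ≤ m) (p : Polynomial F)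
    (hmonic : p.Monic) (hirr : Irreducible p) (hdeg : p.natDegree = m) (h0 : p.coeff 0 ≠ 0)
    (hsd : IsSelfDual q p)
    (K : Type) [Field K] [Fintype K] [Algebra F K] (hK : Fintype.card K = q ^ (2 * m)) :
    Odd m ∧ ∃ lam : K, lam ^ (q ^ m + 1) = 1 ∧
      Function.Injective (fun j : Fin m => lam ^ (q ^ (2 * (j : ℕ)))) ∧
      p.map (algebraMap F K) =
        ∏ j : Fin m, (Polynomial.X - Polynomial.C (lam ^ (q ^ (2 * (j : ℕ))))) := by
  have hq2 : 2 ≤ q := hq.two_le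
  have hrank : Module.finrank F K = m := by
    have h := Module.card_eq_pow_finrank (K := F) (V := K)
    rw [hK, hF, ← pow_mul] at h
    have := Nat.pow_right_injective hq2 h
    omega
  obtain ⟨lam, hlam⟩ : ∃ x : K, aeval x p = 0 := by
    have : Fact (Irreducible p) := ⟨hirr⟩
    have : Module.Finite F (AdjoinRoot p) := (AdjoinRoot.powerBasis hirr.ne_zero).finite
    have : Finite (AdjoinRoot p) := Module.finite_of_finite F
    have hrank' : Module.finrank F (AdjoinRoot p) = m := by
      rw [(AdjoinRoot.powerBasis hirr.ne_zero).finrank, AdjoinRoot.powerBasis_dim, hdeg]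
    obtain ⟨φ⟩ := FiniteField.nonempty_algHom_of_finrank_dvd (F := F) (K := AdjoinRoot p) (L := K)
      (by rw [hrank, hrank'])
    exact ⟨φ (AdjoinRoot.root p), by
      rw [aeval_algHom_apply, AdjoinRoot.aeval_eq, AdjoinRoot.mk_self, map_zero]⟩
  have hmin : minpoly F lam = p := (minpoly.eq_of_irreducible_of_monic hirr hlam hmonic).symm
  have hlam0 : lam ≠ 0 := by
    rintro rfl
    rw [← coeff_zero_eq_aeval_zero', map_eq_zero] at hlam
    exact h0 hlam
  have htop : IntermediateField.adjoin F {lam} = ⊤ :=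
    (Field.primitive_element_iff_minpoly_natDegree_eq F lam).2 (by rw [hmin, hdeg, hrank])
  have hiff {a b : ℕ} : lam ^ (q ^ 2) ^ a = lam ^ (q ^ 2) ^ b ↔ a ≡ b [MOD m] := by
    rw [← hF, ← hrank]
    exact FiniteField.pow_card_pow_eq_pow_card_pow_iff htop
  have hinj : Function.Injective fun j : Fin m => lam ^ (q ^ 2) ^ (j : ℕ) := fun i j h =>
    Fin.ext ((hiff.1 h).eq_of_lt_of_lt i.2 j.2)
  have hprod : p.map (algebraMap F K) = ∏ j : Fin m, (X - C (lam ^ (q ^ 2) ^ (j : ℕ))) := by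
    rw [← hF] at hinj ⊢
    exact FiniteField.map_eq_prod_X_sub_C_pow_card_pow hmonic hdeg hlam hinj
  have hsplit : (p.map (algebraMap F K)).Splits := by
    rw [← hmin]
    exact Normal.splits inferInstance lam
  obtain ⟨k, hk⟩ : ∃ k : ℕ, lam⁻¹ ^ q = lam ^ (q ^ 2) ^ k := by
    have h := hsd.isRoot_inv_pow hirr.ne_zero hsplit hlam
    rw [← eval_map_algebraMap, hprod, eval_prod, Finset.prod_eq_zero_iff] at h
    obtain ⟨j, -, hj⟩ := h
    exact ⟨j, sub_eq_zero.1 (by simpa using hj)⟩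
  have hmod : 2 * k ≡ 1 [MOD m] := by
    rw [← hiff]
    calc lam ^ (q ^ 2) ^ (2 * k) = (lam ^ (q ^ 2) ^ k) ^ (q ^ 2) ^ k := by
          rw [← pow_mul lam, ← pow_add, two_mul]
      _ = ((lam ^ (q ^ 2) ^ k)⁻¹) ^ q := by
          rw [← hk, pow_right_comm, inv_pow, hk]
      _ = lam ^ (q ^ 2) ^ 1 := by
          rw [← hk, inv_pow lam, inv_inv, ← pow_mul, pow_one, sq]
  have hodd : Odd m := by
    by_contra hcon
    have h2 : 2 * k ≡ 1 [MOD 2] := hmod.of_dvd (Nat.not_odd_iff_even.1 hcon).two_dvd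
    simp [Nat.ModEq] at h2
  refine ⟨hodd, lam, ?_, by simpa only [pow_mul] using hinj, by simpa only [pow_mul] using hprod⟩
  obtain ⟨s, hs⟩ := hodd
  have hks : k ≡ s + 1 [MOD m] := by
    have hcop : m.gcd 2 = 1 := by
      rw [hs]; simp
    refine Nat.ModEq.cancel_left_of_coprime hcop (hmod.trans ?_)
    rw [show 2 * (s + 1) = 1 + m by omega]
    simp [Nat.ModEq]
  have hone : (lam ^ (q ^ m + 1)) ^ q = 1 := by
    have hq' : lam⁻¹ ^ q = lam ^ (q ^ m * q) := by
      rw [hk, hiff.2 hks, ← pow_mul, ← pow_succ, hs]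
      ring_nf
    rw [← pow_mul, add_mul, one_mul, pow_add, ← hq', inv_pow, inv_mul_cancel₀ (pow_ne_zero _ hlam0)]
  rw [← FiniteField.pow_card (lam ^ (q ^ m + 1)), hK,
    ← Nat.sub_add_cancel (show 1 ≤ 2 * m by omega), pow_succ' q, pow_mul, hone, one_pow]
end

section
/- For every prime power q and every odd integer n ≥ 1, n · A^-(n)(q) = Σ_{d | n} μ(n/d)·(q^d + 1), where μ is the Möbius function; that is, A^-(n)(q) = (1/n) Σ_{d | n} μ(n/d)(q^d + 1). -/
open Polynomial

/-- `A⁻(d)(q)`: the number of self-dual irreducible monic polynomials of degree `d`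
over `F_{q²}` with nonzero constant term. -/
noncomputable def Aminus (q : ℕ) (F : Type*) [Field F] (d : ℕ) : ℕ :=
  Nat.card {p : Polynomial F //
    p.Monic ∧ p.natDegree = d ∧ p.coeff 0 ≠ 0 ∧ Irreducible p ∧ IsSelfDual q p}

/-- The map `x ↦ x⁻¹ ^ q` that sends the roots of a polynomial to the roots of its dual. -/
def dualRoot {K : Type*} [Field K] (q : ℕ) (x : K) : K := x⁻¹ ^ q

section DualRoot

variable {K : Type*} [Field K] {q : ℕ}

lemma dualRoot_comp_self : dualRoot q ∘ dualRoot q = fun x : K => x ^ q ^ 2 := by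
  ext x
  simp [dualRoot, ← pow_mul, sq]

lemma dualRoot_iterate_two_mul (k : ℕ) (x : K) :
    (dualRoot q)^[2 * k] x = (fun y : K => y ^ q ^ 2)^[k] x := by
  rw [Function.iterate_mul, ← dualRoot_comp_self]
  rfl

lemma dualRoot_iterate_of_odd {n : ℕ} (hn : Odd n) (x : K) :
    (dualRoot q)^[n] x = x⁻¹ ^ q ^ n := by
  obtain ⟨k, rfl⟩ := hn
  rw [Function.iterate_add_apply, dualRoot_iterate_two_mul, pow_iterate]
  simp only [Function.iterate_one, dualRoot]
  ring

lemma isPeriodicPt_dualRoot_iff {n : ℕ} (hn : Odd n) {x : K} (hx : x ≠ 0) :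
    Function.IsPeriodicPt (dualRoot q) n x ↔ x ^ (q ^ n + 1) = 1 := by
  rw [Function.IsPeriodicPt, Function.IsFixedPt, dualRoot_iterate_of_odd hn, inv_pow, pow_succ,
    inv_eq_iff_eq_inv, mul_eq_one_iff_eq_inv₀ hx]

lemma dualRoot_injective (hq : ∃ p, p.Prime ∧ ExpChar K p ∧ ∃ k, q = p ^ k) :
    Function.Injective (dualRoot q : K → K) := by
  obtain ⟨p, _, _, k, rfl⟩ := hq
  intro x y h
  exact inv_injective (iterateFrobenius_inj K p k h)

end DualRoot

/-- Self-duality can be tested on the roots in any field over which the polynomial splits. -/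
lemma isSelfDual_iff_map_aroots {F : Type*} [Field F] {q : ℕ} {p : F[X]} (hp : p ≠ 0)
    (K : Type*) [Field K] [Algebra F K] (hK : (p.map (algebraMap F K)).Splits) :
    IsSelfDual q p ↔ (p.aroots K).map (dualRoot q) = p.aroots K := by
  let φ : p.SplittingField →ₐ[F] K := SplittingField.lift p hK
  have hsplit := SplittingField.splits p
  have haroots : p.aroots K = (p.aroots p.SplittingField).map φ := by
    rw [aroots, ← φ.comp_algebraMap, ← Polynomial.map_map, hsplit.roots_map]
    rfl
  have hcomm : dualRoot q ∘ φ = φ ∘ dualRoot q := by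
    ext x
    simp [dualRoot]
  have hlc : algebraMap F p.SplittingField p.leadingCoeff ≠ 0 := by simpa using hp
  rw [haroots, Multiset.map_map, hcomm, ← Multiset.map_map,
    (Multiset.map_injective (f := φ) φ.toRingHom.injective).eq_iff, IsSelfDual, dualPoly]
  have hprod : ((p.aroots p.SplittingField).map fun α => X - C (α⁻¹ ^ q)) =
      ((p.aroots p.SplittingField).map (dualRoot q)).map fun α => X - C α := by
    rw [Multiset.map_map]
    rfl
  rw [hprod]
  constructor
  · intro h
    have := congrArg roots h
    rwa [roots_C_mul _ hlc, roots_multiset_prod_X_sub_C, eq_comm] at this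
  · intro h
    rw [h]
    simpa using hsplit.eq_prod_roots

section Finite

variable {F : Type*} [Field F] [Fintype F] {K : Type*} [Field K] [Algebra F K]

/-- The degree of an element over a finite field is its period under the Frobenius. -/
lemma natDegree_minpoly_eq_minimalPeriod {x : K} (hx : IsIntegral F x) :
    (minpoly F x).natDegree = Function.minimalPeriod (fun y : K => y ^ Fintype.card F) x := by
  have key : ∀ k, (minpoly F x).natDegree ∣ k ↔
      Function.IsPeriodicPt (fun y : K => y ^ Fintype.card F) k x := by
    intro k
    rw [(minpoly.irreducible hx).natDegree_dvd_iff_dvd_X_pow_card_pow_sub_X, minpoly.dvd_iff,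
      Function.IsPeriodicPt, Function.IsFixedPt, pow_iterate]
    simp [sub_eq_zero]
  exact Nat.dvd_antisymm ((key _).2 (Function.isPeriodicPt_minimalPeriod _ _))
    ((key _).1 dvd_rfl).minimalPeriod_dvd

variable {q : ℕ}

lemma exists_expChar_of_card (hq : IsPrimePow q) (hF : Fintype.card F = q ^ 2) :
    ∃ p, p.Prime ∧ ExpChar K p ∧ ∃ k, q = p ^ k := by
  obtain ⟨p, k, hp, hk, rfl⟩ := hq
  have hp := hp.nat_prime
  have := Fact.mk hp
  have : CharP F p := by
    apply charP_of_card_eq_prime_pow (f := k * 2)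
    rw [hF, pow_mul]
  have : CharP K p := charP_of_injective_algebraMap (algebraMap F K).injective p
  exact ⟨p, hp, .prime hp, k, rfl⟩

/-- The degree over `F` is the period under the square of `dualRoot q`. -/
lemma natDegree_minpoly_eq_minimalPeriod_iterate (hF : Fintype.card F = q ^ 2) {x : K}
    (hx : IsIntegral F x) :
    (minpoly F x).natDegree = Function.minimalPeriod (dualRoot q)^[2] x := by
  rw [natDegree_minpoly_eq_minimalPeriod hx, hF, ← dualRoot_comp_self]
  rfl

lemma aeval_pow_card_iterate_eq_zero {p : F[X]} {x : K} (hx : aeval x p = 0) (k : ℕ) :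
    aeval ((fun y : K => y ^ Fintype.card F)^[k] x) p = 0 := by
  have h := aeval_algHom_apply ((FiniteField.frobeniusAlgHom F K) ^ k) x p
  rw [hx, map_zero] at h
  convert h using 2
  rw [AlgHom.coe_pow]
  rfl

lemma isSelfDual_minpoly_of_odd_minimalPeriod [IsAlgClosed K] (hq : IsPrimePow q)
    (hF : Fintype.card F = q ^ 2) {x : K} (hx : IsIntegral F x) (hx0 : x ≠ 0)
    (hodd : Odd (Function.minimalPeriod (dualRoot q) x)) :
    IsSelfDual q (minpoly F x) := by
  set n := Function.minimalPeriod (dualRoot q) x with hn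
  have hdvd : minpoly F x ∣ X ^ (q ^ n + 1) - 1 := by
    rw [minpoly.dvd_iff]
    simpa [sub_eq_zero] using (isPeriodicPt_dualRoot_iff hodd hx0).1
      (Function.isPeriodicPt_minimalPeriod _ _)
  have hne := minpoly.ne_zero hx
  rw [isSelfDual_iff_map_aroots hne K (IsAlgClosed.splits _)]
  have hnodup : ((minpoly F x).aroots K).Nodup :=
    nodup_aroots_iff_of_splits hne (IsAlgClosed.splits _) |>.2
      (PerfectField.separable_of_irreducible (minpoly.irreducible hx))
  refine Multiset.eq_of_le_of_card_le ((Multiset.le_iff_subset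
    (hnodup.map (dualRoot_injective (exists_expChar_of_card hq hF)))).2 ?_) (by simp)
  intro z hz
  obtain ⟨y, hy, rfl⟩ := Multiset.mem_map.1 hz
  rw [mem_aroots] at hy ⊢
  refine ⟨hne, ?_⟩
  have hy1 : y ^ (q ^ n + 1) = 1 := by
    simpa [sub_eq_zero] using aeval_eq_zero_of_dvd_aeval_eq_zero hdvd hy.2
  have hy0 : y ≠ 0 := by
    rintro rfl
    simp at hy1
  have hper := (isPeriodicPt_dualRoot_iff hodd hy0).2 hy1
  obtain ⟨k, hk⟩ := hodd
  have hyk : dualRoot q y = (fun z : K => z ^ Fintype.card F)^[k + 1] y := by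
    rw [hF, ← dualRoot_iterate_two_mul, show 2 * (k + 1) = n + 1 by omega,
      Function.iterate_succ_apply', hper]
  rw [hyk]
  exact aeval_pow_card_iterate_eq_zero hy.2 _

lemma minimalPeriod_dualRoot_eq_natDegree [IsAlgClosed K] (hF : Fintype.card F = q ^ 2) {x : K}
    (hx : IsIntegral F x) (hdual : IsSelfDual q (minpoly F x)) :
    Function.minimalPeriod (dualRoot q) x = (minpoly F x).natDegree := by
  have hne := minpoly.ne_zero hx
  rw [isSelfDual_iff_map_aroots hne K (IsAlgClosed.splits _)] at hdual
  have hdeg := natDegree_minpoly_eq_minimalPeriod_iterate hF hx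
  have hpos := minpoly.natDegree_pos hx
  set d := (minpoly F x).natDegree with hd
  set m := Function.minimalPeriod (dualRoot q) x with hm
  have hmem : ∀ k, (dualRoot q)^[k] x ∈ (minpoly F x).aroots K := by
    intro k
    induction k with
    | zero => exact (mem_aroots.2 ⟨hne, minpoly.aeval F x⟩)
    | succ k ih =>
      rw [Function.iterate_succ_apply', ← hdual]
      exact Multiset.mem_map_of_mem _ ih
  have hle : m ≤ d := by
    classical
    calc m = ((Finset.range m).image fun k => (dualRoot q)^[k] x).card := by
          rw [Finset.card_image_of_injOn, Finset.card_range]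
          intro a ha b hb hab
          exact Function.iterate_injOn_Iio_minimalPeriod (by simpa using ha) (by simpa using hb) hab
      _ ≤ ((minpoly F x).aroots K).toFinset.card := by
          apply Finset.card_le_card
          intro y hy
          obtain ⟨k, -, rfl⟩ := Finset.mem_image.1 hy
          exact Multiset.mem_toFinset.2 (hmem k)
      _ ≤ ((minpoly F x).aroots K).card := Multiset.toFinset_card_le _
      _ ≤ d := (card_roots' _).trans natDegree_map_le
  have hper : Function.IsPeriodicPt (dualRoot q) (2 * d) x := by
    have := Function.isPeriodicPt_minimalPeriod (dualRoot q)^[2] x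
    rw [← hdeg] at this
    rwa [Function.IsPeriodicPt, Function.iterate_mul]
  have hmpos : 0 < m := hper.minimalPeriod_pos (by omega)
  rw [Function.minimalPeriod_iterate_eq_div_gcd two_ne_zero, ← hm] at hdeg
  rcases Nat.even_or_odd m with he | ho
  · rw [Nat.gcd_eq_right he.two_dvd] at hdeg
    omega
  · rw [Nat.Coprime.gcd_eq_one (Nat.coprime_two_right.2 ho), Nat.div_one] at hdeg
    exact hdeg.symm

lemma minimalPeriod_dualRoot_eq_iff [IsAlgClosed K] (hq : IsPrimePow q)
    (hF : Fintype.card F = q ^ 2) {x : K} (hx : IsIntegral F x) (hx0 : x ≠ 0) {n : ℕ}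
    (hn : Odd n) :
    Function.minimalPeriod (dualRoot q) x = n ↔
      (minpoly F x).natDegree = n ∧ IsSelfDual q (minpoly F x) := by
  constructor
  · rintro rfl
    refine ⟨?_, isSelfDual_minpoly_of_odd_minimalPeriod hq hF hx hx0 hn⟩
    rw [natDegree_minpoly_eq_minimalPeriod_iterate hF hx,
      Function.minimalPeriod_iterate_eq_div_gcd two_ne_zero,
      Nat.Coprime.gcd_eq_one (Nat.coprime_two_right.2 hn), Nat.div_one]
  · rintro ⟨rfl, h⟩
    exact minimalPeriod_dualRoot_eq_natDegree hF hx h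

/-- The nonzero elements of odd period `n` are the roots of the self-dual irreducible polynomials
of degree `n`. -/
lemma natCard_minimalPeriod_eq [IsAlgClosed K] [Algebra.IsAlgebraic F K] (hq : IsPrimePow q)
    (hF : Fintype.card F = q ^ 2) {n : ℕ} (hn : Odd n) :
    Nat.card {x : K // x ≠ 0 ∧ Function.minimalPeriod (dualRoot q) x = n} = n * Aminus q F n := by
  have hint : ∀ x : K, IsIntegral F x := Algebra.IsIntegral.isIntegral
  let f : {x : K // x ≠ 0 ∧ Function.minimalPeriod (dualRoot q) x = n} →
      {p : F[X] // p.Monic ∧ p.natDegree = n ∧ p.coeff 0 ≠ 0 ∧ Irreducible p ∧ IsSelfDual q p} :=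
    fun x => ⟨minpoly F x.1, minpoly.monic (hint _),
      ((minimalPeriod_dualRoot_eq_iff hq hF (hint _) x.2.1 hn).1 x.2.2).1,
      minpoly.coeff_zero_ne_zero (hint _) x.2.1, minpoly.irreducible (hint _),
      ((minimalPeriod_dualRoot_eq_iff hq hF (hint _) x.2.1 hn).1 x.2.2).2⟩
  have hfib : ∀ p, Nat.card {x // f x = p} = n := by
    rintro ⟨p, hmonic, hdeg, hcoeff, hirr, hdual⟩
    have hmin : ∀ x ∈ p.rootSet K, minpoly F x = p := fun x hx =>
      (minpoly.eq_of_irreducible_of_monic hirr (mem_rootSet.1 hx).2 hmonic).symm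
    have e : {x // f x = ⟨p, hmonic, hdeg, hcoeff, hirr, hdual⟩} ≃ p.rootSet K :=
      { toFun := fun x => ⟨x.1.1, mem_rootSet.2 ⟨hmonic.ne_zero, by
          have hx : minpoly F x.1.1 = p := congrArg Subtype.val x.2
          simpa only [hx] using minpoly.aeval F x.1.1⟩⟩
        invFun := fun x =>
          have hx0 : x.1 ≠ 0 := fun h => hcoeff <| by
            have := (mem_rootSet.1 x.2).2
            rwa [h, ← coeff_zero_eq_aeval_zero', map_eq_zero] at this
          ⟨⟨x.1, hx0, (minimalPeriod_dualRoot_eq_iff hq hF (hint _) hx0 hn).2 (by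
            rw [hmin _ x.2]
            exact ⟨hdeg, hdual⟩)⟩, Subtype.ext (hmin _ x.2)⟩
        left_inv := fun _ => rfl
        right_inv := fun _ => rfl }
    rw [Nat.card_congr e, Nat.card_eq_fintype_card, card_rootSet_eq_natDegree
      (PerfectField.separable_of_irreducible hirr) (IsAlgClosed.splits _), hdeg]
  have hfin : ∀ p, Nonempty ({x // f x = p} ≃ Fin n) := fun p =>
    have := Nat.finite_of_card_ne_zero (hfib p ▸ hn.pos.ne')
    ⟨Finite.equivFinOfCardEq (hfib p)⟩
  rw [← Nat.card_congr (Equiv.sigmaFiberEquiv f),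
    Nat.card_congr ((Equiv.sigmaCongrRight fun p => (hfin p).some).trans
      (Equiv.sigmaEquivProd _ _)), Nat.card_prod, Nat.card_fin, mul_comm, Aminus]

/-- Sorting the `(q ^ n + 1)`-th roots of unity by their period under `dualRoot q`. -/
lemma sum_divisors_mul_Aminus (hq : IsPrimePow q)
    (hF : Fintype.card F = q ^ 2) {n : ℕ} (hn : Odd n) :
    ∑ d ∈ n.divisors, d * Aminus q F d = q ^ n + 1 := by
  classical
  let K := AlgebraicClosure F
  have hq0 : (q : K) = 0 := by
    have h : ((q ^ 2 : ℕ) : F) = 0 := by rw [← hF, Nat.cast_card_eq_zero]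
    have : (q : F) = 0 := by simpa using h
    simpa using congrArg (algebraMap F K) this
  have hsep : (X ^ (q ^ n + 1) - 1 : K[X]).Separable := by
    rw [X_pow_sub_one_separable_iff]
    simp [hq0, hn.pos.ne']
  let S := (X ^ (q ^ n + 1) - 1 : K[X]).roots.toFinset
  have hS : ∀ x, x ∈ S ↔ x ≠ 0 ∧ Function.IsPeriodicPt (dualRoot q) n x := by
    intro x
    have : x ∈ S ↔ x ^ (q ^ n + 1) = 1 := by
      simp [S, hsep.ne_zero, sub_eq_zero]
    rw [this]
    constructor
    · intro h
      have hx : x ≠ 0 := by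
        rintro rfl
        simp at h
      exact ⟨hx, (isPeriodicPt_dualRoot_iff hn hx).2 h⟩
    · rintro ⟨hx, h⟩
      exact (isPeriodicPt_dualRoot_iff hn hx).1 h
  have hcard : S.card = q ^ n + 1 := by
    rw [Multiset.toFinset_card_of_nodup (nodup_roots hsep),
      ← (IsAlgClosed.splits _).natDegree_eq_card_roots, ← C_1, natDegree_X_pow_sub_C]
  rw [← hcard, Finset.card_eq_sum_card_fiberwise (f := Function.minimalPeriod (dualRoot q))
    (t := n.divisors)]
  · refine Finset.sum_congr rfl fun d hd => ?_
    have hdn := Nat.dvd_of_mem_divisors hd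
    rw [← natCard_minimalPeriod_eq (K := K) hq hF (hn.of_dvd_nat hdn)]
    refine Nat.subtype_card _ fun x => ?_
    rw [Finset.mem_filter, hS]
    refine ⟨fun h => ⟨h.1.1, h.2⟩, fun h => ⟨⟨h.1, ?_⟩, h.2⟩⟩
    exact Function.isPeriodicPt_iff_minimalPeriod_dvd.2 (h.2 ▸ hdn)
  · intro x hx
    exact Nat.mem_divisors.2 ⟨((hS x).1 hx).2.minimalPeriod_dvd, hn.pos.ne'⟩

end Finite

open ArithmeticFunction in
/-- for odd `n ≥ 1`, `n · A⁻(n)(q) = Σ_{d ∣ n} μ(n/d)(q^d + 1)`. -/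
theorem Aminus_eq_moebius_sum
    (q : ℕ) (hq : IsPrimePow q) (F : Type) [Field F] [Fintype F]
    (hF : Fintype.card F = q ^ 2) (n : ℕ) (hn : 1 ≤ n) (hodd : Odd n) :
    (n : ℤ) * Aminus q F n =
      ∑ d ∈ n.divisors, ArithmeticFunction.moebius (n / d) * ((q : ℤ) ^ d + 1) := by
  have h := (sum_eq_iff_sum_mul_moebius_eq_on (R := ℤ) (f := fun d => (d : ℤ) * Aminus q F d)
    (g := fun d => (q : ℤ) ^ d + 1) {d | Odd d} fun m n hmn hn => Odd.of_dvd_nat hn hmn).1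
    (fun m _ hm => by exact_mod_cast sum_divisors_mul_Aminus hq hF hm) n hn hodd
  rw [← h]
  exact Nat.sum_divisorsAntidiagonal' fun a b => moebius a * ((q : ℤ) ^ b + 1)
end

section
/- Let I be a finite index set, and for each i ∈ I let G_i be a finite group acting on a finite poset P_i that has a least element. Then −χ̃( (∏_{i∈I} P_i)^* ) = ∏_{i∈I} (−χ̃(P_i^*)), and for every r ≥ 1, −χ̃_r( (∏_{i∈I} P_i)^*, ∏_{i∈I} G_i ) = ∏_{i∈I} (−χ̃_r(P_i^*, G_i)), where the product group ∏ G_i acts coordinatewise on the product poset ∏ P_i. -/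
open scoped Classical

/-- The reduced Euler characteristic of a finite poset: the sum of `(-1)^{|σ|+1}` over all
chains `σ`, including the empty chain. -/
noncomputable def redEuler (P : Type*) [PartialOrder P] [Finite P] : ℤ :=
  letI : Fintype P := Fintype.ofFinite P
  ∑ s ∈ Finset.univ.powerset.filter (fun s : Finset P => IsChain (· ≤ ·) (s : Set P)),
    (-1 : ℤ) ^ (s.card + 1)

/-- The `r`-th equivariant reduced Euler characteristic `χ̃_r(P^*, G)` of the poset `P^*`
obtained by removing the least element `⊥` from the finite `G`-poset `P`: the normalized
sum over commuting `r`-tuples in `G` of the reduced Euler characteristics of the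
fixed-point subposets of `P^*`. -/
noncomputable def eqEulerStar (r : ℕ) (G P : Type*) [Group G] [Finite G] [PartialOrder P]
    [OrderBot P] [Finite P] [MulAction G P] : ℚ :=
  letI : Fintype G := Fintype.ofFinite G
  (Fintype.card G : ℚ)⁻¹ *
    ∑ g ∈ Finset.univ.filter (fun g : Fin r → G => ∀ i j, Commute (g i) (g j)),
      (redEuler {x : P // x ≠ ⊥ ∧ ∀ i, g i • x = x} : ℚ)

/-- The sum of `(-1)^{|s|}` over all chains `s` of elements satisfying `p`. -/
noncomputable def chainSum {P : Type*} [PartialOrder P] [Fintype P] (p : P → Prop) : ℤ :=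
  ∑ s ∈ Finset.univ.filter
    (fun s : Finset P => IsChain (· ≤ ·) (s : Set P) ∧ ∀ x ∈ s, p x), (-1 : ℤ) ^ s.card

theorem neg_redEuler_subtype {P : Type*} [PartialOrder P] [Fintype P] (p : P → Prop)
    [Finite {x // p x}] : -redEuler {x : P // p x} = chainSum p := by
  simp only [redEuler, chainSum, pow_succ, mul_neg, mul_one, Finset.sum_neg_distrib, neg_neg]
  refine Finset.sum_bij (fun s _ => s.map (Function.Embedding.subtype p)) ?_ ?_ ?_ ?_
  · intro s hs
    simp only [Finset.mem_filter, Finset.mem_powerset] at hs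
    simp only [Finset.mem_filter, Finset.mem_univ, true_and]
    refine ⟨?_, ?_⟩
    · intro a ha b hb hab
      simp only [Finset.coe_map, Set.mem_image, Finset.mem_coe,
        Function.Embedding.subtype_apply] at ha hb
      obtain ⟨a, ha, rfl⟩ := ha
      obtain ⟨b, hb, rfl⟩ := hb
      exact hs.2 ha hb (fun h => hab (congrArg _ h))
    · intro x hx
      exact Finset.property_of_mem_map_subtype s hx
  · intro s _ t _ h
    exact Finset.map_injective _ h
  · intro t ht
    simp only [Finset.mem_filter, Finset.mem_univ, true_and] at ht
    refine ⟨t.subtype p, ?_, Finset.subtype_map_of_mem ht.2⟩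
    simp only [Finset.mem_filter, Finset.mem_powerset]
    refine ⟨fun x _ => @Finset.mem_univ _ (_) x, ?_⟩
    intro a ha b hb hab
    simp only [Finset.mem_coe, Finset.mem_subtype] at ha hb
    exact ht.1 ha hb (fun h => hab (Subtype.ext h))
  · intro s _
    rw [Finset.card_map]

/-- The part of `chainSum` coming from chains avoiding `⊥` whose largest element is `x`, where the
empty chain counts as having largest element `⊥`. -/
noncomputable def chainSumTop {P : Type*} [PartialOrder P] [OrderBot P] [Fintype P]
    (p : P → Prop) (x : P) : ℤ :=
  ∑ s ∈ Finset.univ.filter (fun s : Finset P =>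
    (IsChain (· ≤ ·) (s : Set P) ∧ ∀ y ∈ s, y ≠ ⊥ ∧ p y) ∧
      IsGreatest (insert ⊥ (s : Set P)) x), (-1 : ℤ) ^ s.card

section
variable {P : Type*} [PartialOrder P] [OrderBot P] [Fintype P]

theorem IsChain.exists_isGreatest_insert_bot {s : Finset P} (hs : IsChain (· ≤ ·) (s : Set P)) :
    ∃ x, IsGreatest (insert ⊥ (s : Set P)) x := by
  have hc : IsChain (· ≤ ·) (insert ⊥ (s : Set P)) := hs.insert fun _ _ _ => Or.inl bot_le
  obtain ⟨m, hm⟩ := (Set.toFinite (insert ⊥ (s : Set P))).exists_maximal ⟨⊥, Or.inl rfl⟩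
  refine ⟨m, hm.prop, fun y hy => ?_⟩
  rcases hc.total hm.prop hy with h | h
  · exact hm.le_of_ge hy h
  · exact h

theorem sum_chainSumTop_filter (p q : P → Prop) :
    ∑ x with q x, chainSumTop p x =
      ∑ s ∈ Finset.univ.filter (fun s : Finset P =>
        (IsChain (· ≤ ·) (s : Set P) ∧ ∀ y ∈ s, y ≠ ⊥ ∧ p y) ∧
          ∃ x, q x ∧ IsGreatest (insert ⊥ (s : Set P)) x), (-1 : ℤ) ^ s.card := by
  simp only [chainSumTop]
  rw [Finset.sum_sigma']
  refine Finset.sum_bij (fun a _ => a.2) ?_ ?_ ?_ ?_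
  · rintro ⟨x, s⟩ h
    simp only [Finset.mem_sigma, Finset.mem_filter, Finset.mem_univ, true_and] at h ⊢
    exact ⟨h.2.1, x, h.1, h.2.2⟩
  · rintro ⟨x, s⟩ h ⟨y, t⟩ h' (rfl : s = t)
    simp only [Finset.mem_sigma, Finset.mem_filter, Finset.mem_univ, true_and] at h h'
    rw [h.2.2.unique h'.2.2]
  · intro s h
    simp only [Finset.mem_filter, Finset.mem_univ, true_and] at h
    obtain ⟨h, x, hq, hx⟩ := h
    exact ⟨⟨x, s⟩, by simpa using ⟨hq, h, hx⟩, rfl⟩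
  · intro _ _
    rfl

theorem sum_chainSumTop (p : P → Prop) :
    ∑ x, chainSumTop p x = chainSum fun x => x ≠ ⊥ ∧ p x := by
  have h := sum_chainSumTop_filter p fun _ => True
  rw [Finset.filter_true] at h
  rw [h, chainSum]
  refine Finset.sum_congr (Finset.ext fun s => ?_) fun _ _ => rfl
  simp only [Finset.mem_filter, Finset.mem_univ, true_and]
  exact ⟨fun h => h.1, fun h => ⟨h, h.1.exists_isGreatest_insert_bot⟩⟩

theorem chainSumTop_eq_zero {p : P → Prop} (hp : p ⊥) {x : P} (hx : ¬ p x) :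
    chainSumTop p x = 0 := by
  rw [chainSumTop, Finset.filter_eq_empty_iff.2, Finset.sum_empty]
  rintro s - ⟨⟨-, h⟩, hg⟩
  rcases hg.1 with rfl | hm
  · exact hx hp
  · exact hx (h x hm).2

/-- `chainSumTop p` satisfies the defining recursion of the Möbius function `μ(⊥, ·)` of the
subposet cut out by `p`. -/
theorem sum_chainSumTop_le {p : P → Prop} {x : P} (hx : p x) :
    ∑ y with y ≤ x, chainSumTop p y = if x = ⊥ then 1 else 0 := by
  rw [sum_chainSumTop_filter]
  have key : ∀ s : Finset P, ((IsChain (· ≤ ·) (s : Set P) ∧ ∀ y ∈ s, y ≠ ⊥ ∧ p y) ∧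
        ∃ y, y ≤ x ∧ IsGreatest (insert ⊥ (s : Set P)) y) ↔
      (IsChain (· ≤ ·) (s : Set P) ∧ ∀ y ∈ s, (y ≠ ⊥ ∧ p y) ∧ y ≤ x) := by
    intro s
    constructor
    · rintro ⟨⟨hc, h⟩, y, hy, hg⟩
      exact ⟨hc, fun z hz => ⟨h z hz, (hg.2 (Or.inr hz)).trans hy⟩⟩
    · rintro ⟨hc, h⟩
      obtain ⟨y, hy⟩ := hc.exists_isGreatest_insert_bot
      refine ⟨⟨hc, fun z hz => (h z hz).1⟩, y, ?_, hy⟩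
      rcases hy.1 with rfl | hm
      · exact bot_le
      · exact (h y hm).2
  simp only [key]
  split_ifs with hbot
  · subst hbot
    rw [Finset.sum_eq_single ∅]
    · simp
    · intro s hs hne
      obtain ⟨y, hy⟩ := Finset.nonempty_iff_ne_empty.2 hne
      have := (Finset.mem_filter.1 hs).2.2 y hy
      exact absurd (le_bot_iff.1 this.2) this.1.1
    · intro h
      simp at h
  · refine Finset.sum_involution
      (fun s _ => if x ∈ s then s.erase x else insert x s) ?_ ?_ ?_ ?_
    · intro s _
      by_cases h : x ∈ s
      · simp only [h, if_true]
        rw [← Finset.card_erase_add_one h, pow_succ]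
        ring
      · simp only [h, if_false]
        rw [Finset.card_insert_of_notMem h, pow_succ]
        ring
    · intro s _ _ heq
      by_cases h : x ∈ s
      · simp [h] at heq
      · simp [h] at heq
    · intro s hs
      obtain ⟨hc, hs⟩ := (Finset.mem_filter.1 hs).2
      refine Finset.mem_filter.2 ⟨Finset.mem_univ _, ?_⟩
      by_cases h : x ∈ s
      · simp only [h, if_true]
        exact ⟨hc.mono (Finset.coe_subset.2 (Finset.erase_subset _ _)),
          fun y hy => hs y (Finset.mem_of_mem_erase hy)⟩
      · simp only [h, if_false]
        refine ⟨?_, fun y hy => ?_⟩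
        · rw [Finset.coe_insert]
          exact hc.insert fun y hy _ => Or.inr (hs y hy).2
        · rcases Finset.mem_insert.1 hy with rfl | hy
          · exact ⟨⟨hbot, hx⟩, le_rfl⟩
          · exact hs y hy
    · intro s _
      by_cases h : x ∈ s
      · simp [h]
      · simp [h]

end

/-- Two functions supported on `p` are equal if their sums over principal lower sets agree. -/
theorem eq_of_sum_le_eq {P : Type*} [PartialOrder P] [Fintype P] {p : P → Prop}
    {f g : P → ℤ} (hf : ∀ x, ¬ p x → f x = 0)
    (hg : ∀ x, ¬ p x → g x = 0)
    (h : ∀ x, p x → ∑ y with y ≤ x, f y = ∑ y with y ≤ x, g y) : f = g := by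
  funext x
  induction x using WellFoundedLT.induction with
  | ind x ih =>
    by_cases hx : p x
    · have hsum := h x hx
      have hmem : x ∈ Finset.univ.filter (· ≤ x) := by simp
      rw [← Finset.add_sum_erase _ f hmem, ← Finset.add_sum_erase _ g hmem] at hsum
      rw [Finset.sum_congr rfl fun y hy => ih y ?_] at hsum
      · exact add_right_cancel hsum
      · simp only [Finset.mem_erase, Finset.mem_filter, Finset.mem_univ, true_and] at hy
        exact lt_of_le_of_ne hy.2 hy.1
    · rw [hf x hx, hg x hx]

section
variable {ι : Type*} [Fintype ι] {P : ι → Type*} [∀ i, PartialOrder (P i)] [∀ i, OrderBot (P i)]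
  [∀ i, Fintype (P i)]

theorem chainSumTop_pi {p : ∀ i, P i → Prop} (hp : ∀ i, p i ⊥) :
    chainSumTop (fun x : ∀ i, P i => ∀ i, p i (x i)) =
      fun x => ∏ i, chainSumTop (p i) (x i) := by
  refine eq_of_sum_le_eq (p := fun x : ∀ i, P i => ∀ i, p i (x i))
    (fun x hx => chainSumTop_eq_zero hp hx) (fun x hx => ?_) (fun x hx => ?_)
  · obtain ⟨i, hi⟩ := not_forall.1 hx
    exact Finset.prod_eq_zero (Finset.mem_univ i) (chainSumTop_eq_zero (hp i) hi)
  · rw [sum_chainSumTop_le (p := fun x : ∀ i, P i => ∀ i, p i (x i)) hx]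
    have hpi : Finset.univ.filter (· ≤ x) =
        Fintype.piFinset fun i => Finset.univ.filter (· ≤ x i) := by
      ext y
      simp [Pi.le_def]
    rw [hpi, ← Finset.prod_univ_sum, Finset.prod_congr rfl fun i _ => sum_chainSumTop_le (hx i)]
    simp [Finset.prod_ite_zero, funext_iff]

theorem chainSum_pi {p : ∀ i, P i → Prop} (hp : ∀ i, p i ⊥) :
    chainSum (fun x : ∀ i, P i => x ≠ ⊥ ∧ ∀ i, p i (x i)) =
      ∏ i, chainSum fun x : P i => x ≠ ⊥ ∧ p i x := by
  rw [← sum_chainSumTop (fun x : ∀ i, P i => ∀ i, p i (x i)), chainSumTop_pi hp]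
  simp only [← sum_chainSumTop]
  rw [Finset.prod_univ_sum, Fintype.piFinset_univ]

end

theorem neg_eqEulerStar (r : ℕ) (G P : Type*) [Group G] [Fintype G] [PartialOrder P]
    [OrderBot P] [Fintype P] [MulAction G P] :
    -eqEulerStar r G P = (Fintype.card G : ℚ)⁻¹ *
      ∑ g : Fin r → G with ∀ i j, Commute (g i) (g j),
        (chainSum (fun x : P => x ≠ ⊥ ∧ ∀ i, g i • x = x) : ℚ) := by
  simp only [← neg_redEuler_subtype]
  rw [eqEulerStar, ← mul_neg, ← Finset.sum_neg_distrib]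
  simp only [Int.cast_neg]
  convert rfl

theorem smul_bot_of_monotone {G P : Type*} [Group G] [PartialOrder P] [OrderBot P]
    [MulAction G P] (hmono : ∀ g : G, Monotone fun x : P => g • x) (g : G) :
    g • (⊥ : P) = ⊥ := by
  have h : g • (⊥ : P) ≤ g • g⁻¹ • (⊥ : P) := hmono g bot_le
  rwa [smul_inv_smul, le_bot_iff] at h

/-- for finite groups `Gᵢ` acting (by order automorphisms) on finite posets
`Pᵢ` with least elements, `−χ̃((∏ᵢ Pᵢ)^*) = ∏ᵢ (−χ̃(Pᵢ^*))` and, for every `r ≥ 1`,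
`−χ̃_r((∏ᵢ Pᵢ)^*, ∏ᵢ Gᵢ) = ∏ᵢ (−χ̃_r(Pᵢ^*, Gᵢ))`, the product group acting
coordinatewise on the product poset. -/
theorem negEuler_product_posets
    (ι : Type) [Fintype ι] (G : ι → Type) (P : ι → Type)
    [∀ i, Group (G i)] [∀ i, Finite (G i)] [∀ i, PartialOrder (P i)] [∀ i, OrderBot (P i)]
    [∀ i, Finite (P i)] [∀ i, MulAction (G i) (P i)]
    (hmono : ∀ (i : ι) (g : G i), Monotone fun x : P i => g • x) (r : ℕ) (hr : 1 ≤ r) :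
    (-redEuler {x : ∀ i, P i // x ≠ ⊥} = ∏ i, -redEuler {x : P i // x ≠ ⊥}) ∧
    (-eqEulerStar r (∀ i, G i) (∀ i, P i) = ∏ i, -eqEulerStar r (G i) (P i)) := by
  have := fun i => Fintype.ofFinite (P i)
  have := fun i => Fintype.ofFinite (G i)
  constructor
  · simp only [neg_redEuler_subtype]
    simpa using chainSum_pi (P := P) (p := fun _ _ => True) fun _ => trivial
  · simp only [neg_eqEulerStar]
    have hfix : ∀ g : Fin r → ∀ i, G i,
        chainSum (fun x : ∀ i, P i => x ≠ ⊥ ∧ ∀ j, g j • x = x) =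
          ∏ i, chainSum fun x : P i => x ≠ ⊥ ∧ ∀ j, g j i • x = x := by
      intro g
      rw [← chainSum_pi fun i j => smul_bot_of_monotone (hmono i) (g j i)]
      congr! 3 with x
      simp only [funext_iff, Pi.smul_apply']
      exact forall_comm
    simp only [hfix, Int.cast_prod]
    rw [Finset.prod_mul_distrib, Finset.prod_inv_distrib, Fintype.card_pi, Nat.cast_prod,
      Finset.prod_univ_sum]
    congr 1
    refine Finset.sum_equiv (Equiv.piComm _) (fun g => ?_) fun _ _ => rfl
    simp only [Finset.mem_filter, Finset.mem_univ, true_and, Fintype.mem_piFinset,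
      Equiv.piComm_apply, Function.swap, Pi.commute_iff]
    exact ⟨fun h i j k => h j k i, fun h j k i => h i j k⟩
end

section
/- For integers r ≥ 1 and n ≥ 1, consider the polynomial P_{r,n}(q) = Σ_{n_0+⋯+n_{r−1}=n} ∏_{j=0}^{r−1} (−1)^{j·n_j} · C((−1)^j·C(r−1,j), n_j) · q^{n_j(r−1−j)} in ℤ[q], the sum over all weak compositions of n into r parts. Then P_{r,n} is divisible in ℤ[q] by (q+1)^{r−1} when r is even, and divisible by (q+1)^{r−1}·q^{n−1} when r is odd. -/
/-- The generalized binomial coefficient `C(a,k) = a(a−1)⋯(a−k+1)/k!` for an integer `a`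
(the division is exact). -/
noncomputable def genChooseInt (a : ℤ) (k : ℕ) : ℤ :=
  (∏ i ∈ Finset.range k, (a - (i : ℤ))) / (Nat.factorial k : ℤ)

theorem prod_sub_range_eq_factorial_mul_genChooseInt (a : ℤ) (k : ℕ) :
    ∏ i ∈ Finset.range k, (a - (i : ℤ)) = (k.factorial : ℤ) * genChooseInt a k := by
  refine (Int.mul_ediv_cancel' ?_).symm
  rw [← descPochhammer_eval_eq_prod_range, Polynomial.eval_eq_smeval,
    Ring.descPochhammer_eq_factorial_smul_choose, nsmul_eq_mul]
  exact dvd_mul_right _ _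

theorem succ_mul_genChooseInt_succ (a : ℤ) (k : ℕ) :
    ((k : ℤ) + 1) * genChooseInt a (k + 1) = (a - k) * genChooseInt a k := by
  have h := prod_sub_range_eq_factorial_mul_genChooseInt a (k + 1)
  rw [Finset.prod_range_succ, prod_sub_range_eq_factorial_mul_genChooseInt,
    Nat.factorial_succ] at h
  push_cast at h
  apply mul_left_cancel₀ (Nat.cast_ne_zero.mpr k.factorial_ne_zero : (k.factorial : ℤ) ≠ 0)
  linear_combination -h

theorem genChooseInt_one_of_two_le {k : ℕ} (hk : 2 ≤ k) : genChooseInt 1 k = 0 := by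
  have h : ∏ i ∈ Finset.range k, ((1 : ℤ) - (i : ℤ)) = 0 :=
    Finset.prod_eq_zero (Finset.mem_range.mpr hk) (by simp)
  simp [genChooseInt, h]

theorem PowerSeries.derivative_prod_of_derivative_eq_mul {R ι : Type*} [CommRing R]
    (s : Finset ι) (f g : ι → PowerSeries R)
    (h : ∀ i ∈ s, PowerSeries.derivative R (f i) = g i * f i) :
    PowerSeries.derivative R (∏ i ∈ s, f i) = (∑ i ∈ s, g i) * ∏ i ∈ s, f i := by
  classical
  induction s using Finset.induction_on with
  | empty => simp
  | insert i s hi ih =>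
    rw [Finset.prod_insert hi, Finset.sum_insert hi, Derivation.leibniz,
      ih fun j hj => h j (Finset.mem_insert_of_mem hj), h i (Finset.mem_insert_self i s),
      smul_eq_mul, smul_eq_mul]
    ring

theorem PowerSeries.coeff_prod_fin {R : Type*} [CommSemiring R] {r : ℕ}
    (f : Fin r → PowerSeries R) (n : ℕ) :
    PowerSeries.coeff n (∏ j, f j) =
      ∑ c ∈ Finset.Nat.antidiagonalTuple r n, ∏ j, PowerSeries.coeff (c j) (f j) := by
  rw [PowerSeries.coeff_prod]
  refine Finset.sum_bij' (fun l _ => ⇑l) (fun c _ => Finsupp.equivFunOnFinite.symm c)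
    ?_ ?_ ?_ ?_ ?_ <;> simp [Finset.Nat.mem_antidiagonalTuple]

/-- The power series `(1 + u T) ^ a` for an integer exponent `a`. -/
noncomputable def intBinomialSeries {R : Type*} [CommRing R] (a : ℤ) (u : R) : PowerSeries R :=
  PowerSeries.mk fun k => (genChooseInt a k : R) * u ^ k

theorem one_add_mul_derivative_intBinomialSeries {R : Type*} [CommRing R] (a : ℤ) (u : R) :
    (1 + PowerSeries.C u * PowerSeries.X) * PowerSeries.derivative R (intBinomialSeries a u) =
      PowerSeries.C (a * u) * intBinomialSeries a u := by
  ext n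
  have h (k : ℕ) := congrArg (Int.cast : ℤ → R) (succ_mul_genChooseInt_succ a k)
  push_cast at h
  rw [add_mul, one_mul, mul_assoc, map_add, PowerSeries.coeff_C_mul, PowerSeries.coeff_C_mul]
  cases n with
  | zero =>
    have h0 := h 0
    simp only [intBinomialSeries, PowerSeries.coeff_derivative, PowerSeries.coeff_mk,
      PowerSeries.coeff_zero_X_mul]
    push_cast at h0 ⊢
    linear_combination u * h0
  | succ n =>
    have h1 := h (n + 1)
    simp only [intBinomialSeries, PowerSeries.coeff_derivative, PowerSeries.coeff_mk,
      PowerSeries.coeff_succ_X_mul]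
    push_cast at h1 ⊢
    linear_combination u ^ (n + 2) * h1

theorem mk_neg_pow_mul_one_add {R : Type*} [CommRing R] (u : R) :
    PowerSeries.mk (fun k => (-u) ^ k) * (1 + PowerSeries.C u * PowerSeries.X) = 1 := by
  ext n
  rw [mul_comm, add_mul, one_mul, mul_assoc, map_add, PowerSeries.coeff_C_mul]
  cases n with
  | zero => simp
  | succ n =>
    simp only [PowerSeries.coeff_mk, PowerSeries.coeff_succ_X_mul, PowerSeries.coeff_one]
    simp [pow_succ, mul_comm]

theorem derivative_intBinomialSeries {R : Type*} [CommRing R] (a : ℤ) (u : R) :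
    PowerSeries.derivative R (intBinomialSeries a u) =
      (PowerSeries.C (a * u) * PowerSeries.mk fun k => (-u) ^ k) * intBinomialSeries a u := by
  calc _ = PowerSeries.mk (fun k => (-u) ^ k) * ((1 + PowerSeries.C u * PowerSeries.X) *
        PowerSeries.derivative R (intBinomialSeries a u)) := by
        rw [← mul_assoc, mk_neg_pow_mul_one_add, one_mul]
    _ = _ := by rw [one_add_mul_derivative_intBinomialSeries]; ring

open Polynomial in
/-- The generating function `∏_{j ≤ m} (1 + (-1)ʲ qᵐ⁻ʲ T) ^ ((-1)ʲ C(m,j))` of the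
polynomials `P_{m+1,n}`. -/
noncomputable def eulerSeries (m : ℕ) : PowerSeries ℤ[X] :=
  ∏ j : Fin (m + 1), intBinomialSeries ((-1) ^ (j : ℕ) * (m.choose j : ℤ))
    ((-1) ^ (j : ℕ) * X ^ (m - j))

open Polynomial in
/-- The logarithmic derivative of `eulerSeries` has coefficients divisible by `(q + 1) ^ m`. -/
theorem exists_derivative_eulerSeries (m : ℕ) :
    ∃ L : PowerSeries ℤ[X], PowerSeries.derivative _ (eulerSeries m) = L * eulerSeries m ∧
      ∀ k, (X + 1 : ℤ[X]) ^ m ∣ PowerSeries.coeff k L := by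
  refine ⟨_, PowerSeries.derivative_prod_of_derivative_eq_mul _ _ _
    fun j _ => derivative_intBinomialSeries _ _, fun k => ?_⟩
  have key : PowerSeries.coeff k (∑ j : Fin (m + 1),
      PowerSeries.C ((((-1) ^ (j : ℕ) * (m.choose j : ℤ) : ℤ) : ℤ[X]) *
        ((-1) ^ (j : ℕ) * X ^ (m - j))) *
      PowerSeries.mk fun k => (-((-1) ^ (j : ℕ) * X ^ (m - j) : ℤ[X])) ^ k) =
      (-1) ^ k * ((-1) ^ k + X ^ (k + 1)) ^ m := by
    rw [add_pow, Finset.mul_sum, map_sum, ← Fin.sum_univ_eq_sum_range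
      (fun j => (-1 : ℤ[X]) ^ k * (((-1) ^ k) ^ j * (X ^ (k + 1)) ^ (m - j) * (m.choose j : ℤ[X])))]
    refine Finset.sum_congr rfl fun j _ => ?_
    rw [PowerSeries.coeff_C_mul, PowerSeries.coeff_mk, neg_pow ((-1) ^ (j : ℕ) * X ^ (m - j) : ℤ[X]),
      mul_pow ((-1) ^ (j : ℕ) : ℤ[X])]
    push_cast
    have h : ((-1 : ℤ[X]) ^ (j : ℕ)) * (-1) ^ (j : ℕ) = 1 := by
      rw [← mul_pow]; simp
    rw [← pow_mul, ← pow_mul, ← pow_mul, ← pow_mul, mul_comm k (j : ℕ)]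
    rw [mul_comm (k + 1), mul_add, pow_add X, mul_one]
    linear_combination
      (m.choose j : ℤ[X]) * X ^ (m - j) * (-1) ^ k * (-1) ^ (j * k : ℕ) * X ^ ((m - j) * k) * h
  rw [key]
  refine Dvd.dvd.mul_left (pow_dvd_pow_of_dvd ?_ m) _
  have h := sub_dvd_pow_sub_pow (X : ℤ[X]) (-1) (k + 1)
  rwa [sub_neg_eq_add, pow_succ (-1 : ℤ[X]), mul_neg_one, sub_neg_eq_add, add_comm (X ^ _)] at h

open Polynomial in
theorem X_add_one_pow_dvd_coeff_eulerSeries (m : ℕ) {n : ℕ} (hn : n ≠ 0) :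
    (X + 1 : ℤ[X]) ^ m ∣ PowerSeries.coeff n (eulerSeries m) := by
  obtain ⟨n, rfl⟩ := Nat.exists_eq_succ_of_ne_zero hn
  obtain ⟨L, hL, hdvd⟩ := exists_derivative_eulerSeries m
  have h := congrArg (PowerSeries.coeff n) hL
  rw [PowerSeries.coeff_derivative, PowerSeries.coeff_mul] at h
  have hprime : Prime (X + 1 : ℤ[X]) := by
    simpa using prime_X_sub_C (-1 : ℤ)
  refine hprime.pow_dvd_of_dvd_mul_right m (b := (n + 1 : ℤ[X])) (fun h1 => ?_) ?_
  · have h2 := eval_dvd (x := (-1 : ℤ)) h1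
    simp at h2
    lia
  · rw [h]
    exact Finset.dvd_sum fun p _ => (hdvd _).mul_right _

open Polynomial in
theorem X_pow_dvd_coeff_eulerSeries {m : ℕ} (hm : Even m) (n : ℕ) :
    (X : ℤ[X]) ^ (n - 1) ∣ PowerSeries.coeff n (eulerSeries m) := by
  rw [eulerSeries, PowerSeries.coeff_prod_fin]
  refine Finset.dvd_sum fun c hc => ?_
  rw [Finset.Nat.mem_antidiagonalTuple, Fin.sum_univ_castSucc] at hc
  rw [Fin.prod_univ_castSucc]
  simp only [intBinomialSeries, PowerSeries.coeff_mk, Fin.val_last, Fin.val_castSucc,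
    hm.neg_one_pow, Nat.choose_self, Nat.cast_one, mul_one]
  obtain h | h := le_or_gt 2 (c (Fin.last m))
  · simp [genChooseInt_one_of_two_le h]
  · refine Dvd.dvd.mul_right ((pow_dvd_pow X (show n - 1 ≤ ∑ i : Fin m, c i.castSucc by lia)).trans
      ?_) _
    rw [← Finset.prod_pow_eq_pow_sum]
    refine Finset.prod_dvd_prod_of_dvd _ _ fun j _ => Dvd.dvd.mul_left (pow_dvd_pow_of_dvd ?_ _) _
    exact Dvd.dvd.mul_left (dvd_pow_self X (by lia)) _

open Polynomial in
theorem coeff_eulerSeries (m n : ℕ) :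
    PowerSeries.coeff n (eulerSeries m) =
      ∑ c ∈ Finset.Nat.antidiagonalTuple (m + 1) n, ∏ j : Fin (m + 1),
        C ((-1 : ℤ) ^ ((j : ℕ) * c j) *
          genChooseInt ((-1 : ℤ) ^ (j : ℕ) * (m.choose (j : ℕ))) (c j)) *
            X ^ (c j * (m - (j : ℕ))) := by
  rw [eulerSeries, PowerSeries.coeff_prod_fin]
  refine Finset.sum_congr rfl fun c _ => Finset.prod_congr rfl fun j _ => ?_
  rw [intBinomialSeries, PowerSeries.coeff_mk, mul_pow, ← pow_mul, ← pow_mul,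
    mul_comm (m - (j : ℕ))]
  simp only [map_mul, map_pow, map_neg, map_one, eq_intCast]
  ring

/-- the polynomial
`P_{r,n}(q) = Σ_{n₀+⋯+n_{r−1}=n} ∏_{j<r} (−1)^{j·nⱼ} C((−1)ʲ C(r−1,j), nⱼ) q^{nⱼ(r−1−j)} ∈ ℤ[q]`
is divisible by `(q+1)^{r−1}` for even `r` and by `(q+1)^{r−1} q^{n−1}` for odd `r`. -/
theorem divisibility_of_euler_polynomial (r n : ℕ) (hr : 1 ≤ r) (hn : 1 ≤ n) :
    (Even r →
      (Polynomial.X + 1 : Polynomial ℤ) ^ (r - 1) ∣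
        ∑ c ∈ Finset.Nat.antidiagonalTuple r n,
          ∏ j : Fin r,
            Polynomial.C ((-1 : ℤ) ^ ((j : ℕ) * c j) *
                genChooseInt ((-1 : ℤ) ^ (j : ℕ) * ((r - 1).choose (j : ℕ))) (c j)) *
              Polynomial.X ^ (c j * (r - 1 - (j : ℕ)))) ∧
    (Odd r →
      (Polynomial.X + 1 : Polynomial ℤ) ^ (r - 1) * Polynomial.X ^ (n - 1) ∣
        ∑ c ∈ Finset.Nat.antidiagonalTuple r n,
          ∏ j : Fin r,
            Polynomial.C ((-1 : ℤ) ^ ((j : ℕ) * c j) *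
                genChooseInt ((-1 : ℤ) ^ (j : ℕ) * ((r - 1).choose (j : ℕ))) (c j)) *
              Polynomial.X ^ (c j * (r - 1 - (j : ℕ)))) := by
  obtain ⟨m, rfl⟩ := Nat.exists_eq_add_of_le' hr
  have hdvd := X_add_one_pow_dvd_coeff_eulerSeries m (Nat.one_le_iff_ne_zero.mp hn)
  simp only [Nat.add_sub_cancel, ← coeff_eulerSeries]
  refine ⟨fun _ => hdvd, fun hodd => IsCoprime.mul_dvd (IsCoprime.pow ⟨1, -1, by ring⟩) hdvd
    (X_pow_dvd_coeff_eulerSeries ?_ n)⟩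
  simpa [Nat.odd_add_one] using hodd
end
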